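/- arXiv:2212.13549 — 7 statements merged into one kernel-verified Lean document; each statement's English description precedes it below -/
import Mathlib

section
/- Let (M,d) be a bounded metric space and let S be a group acting on M by self-maps, each of which is orbit-nonexpansive. Then the family S is interlaced orbit-nonexpansive, i.e. d(t x, s y) ≤ sup{ D(x, o_r(y)) : r ∈ S } for all s, t ∈ S and all x, y ∈ M. -/
open Metric Set

/-- The orbit of `x` under `T`: `{x} ∪ {Tⁿ x : n ≥ 1}`. -/
def orbitOf {M : Type*} (T : M → M) (x : M) : Set M :=
  Set.range fun n : ℕ => T^[n] x

/-- `D(x,A) = sup { d(x,a) : a ∈ A }`. -/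
noncomputable def Dsup {M : Type*} [MetricSpace M] (x : M) (A : Set M) : ℝ :=
  sSup (dist x '' A)

/-- A self-map `T` is orbit-nonexpansive if `d(Tx,Ty) ≤ D(x, o_T(y))` for all `x,y`. -/
def OrbitNonexpansive {M : Type*} [MetricSpace M] (T : M → M) : Prop :=
  ∀ x y : M, dist (T x) (T y) ≤ Dsup x (orbitOf T y)

/-- A set is admissible if it is an intersection of closed balls. -/
def Admissible {M : Type*} [MetricSpace M] (A : Set M) : Prop :=
  ∃ C : Set (M × ℝ), A = ⋂ p ∈ C, Metric.closedBall p.1 p.2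

/-- The family of admissible sets is compact: any collection of admissible sets whose
finite subcollections have nonempty intersection has nonempty intersection. -/
def AdmissibleCompact (M : Type*) [MetricSpace M] : Prop :=
  ∀ 𝒞 : Set (Set M), (∀ A ∈ 𝒞, Admissible A) →
    (∀ 𝒟 ⊆ 𝒞, 𝒟.Finite → (⋂₀ 𝒟).Nonempty) → (⋂₀ 𝒞).Nonempty

/-- Metric normal structure: every admissible set with more than one point contains a
point `z` with `D(z,A) < δ(A)`. -/
def MetricNormalStructure (M : Type*) [MetricSpace M] : Prop :=
  ∀ A : Set M, Admissible A → A.Nontrivial → ∃ z ∈ A, Dsup z A < Metric.diam A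

/-- `D` is a one-local retract of `M`: any family of closed balls centered in `D` with
nonempty intersection meets `D`. -/
def OneLocalRetract {M : Type*} [MetricSpace M] (D : Set M) : Prop :=
  ∀ C : Set (M × ℝ), (∀ p ∈ C, p.1 ∈ D) →
    (⋂ p ∈ C, Metric.closedBall p.1 p.2).Nonempty →
    ((⋂ p ∈ C, Metric.closedBall p.1 p.2) ∩ D).Nonempty

/-- A family `F` of self-maps is interlaced orbit-nonexpansive if
`d(Tx,Sy) ≤ sup { D(x, o_R(y)) : R ∈ F }` for all `T,S ∈ F` and `x,y ∈ M`. -/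
def InterlacedFamily {M : Type*} [MetricSpace M] (F : Set (M → M)) : Prop :=
  ∀ T ∈ F, ∀ S ∈ F, ∀ x y : M,
    dist (T x) (S y) ≤ sSup ((fun R => Dsup x (orbitOf R y)) '' F)

/-- `B[A,r] = ⋂_{x ∈ A} B̄(x,r)`. -/
def Bball {M : Type*} [MetricSpace M] (A : Set M) (r : ℝ) : Set M :=
  ⋂ x ∈ A, Metric.closedBall x r

theorem bddAbove_dist_image {M : Type*} [MetricSpace M]
    (hM : Bornology.IsBounded (Set.univ : Set M)) (x : M) (A : Set M) :
    BddAbove (dist x '' A) := by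
  refine ⟨Metric.diam (Set.univ : Set M), ?_⟩
  rintro _ ⟨a, -, rfl⟩
  exact Metric.dist_le_diam_of_mem hM (Set.mem_univ x) (Set.mem_univ a)

theorem Dsup_le_diam {M : Type*} [MetricSpace M]
    (hM : Bornology.IsBounded (Set.univ : Set M)) (x : M) (A : Set M) :
    Dsup x A ≤ Metric.diam (Set.univ : Set M) := by
  refine Real.sSup_le ?_ Metric.diam_nonneg
  rintro _ ⟨a, -, rfl⟩
  exact Metric.dist_le_diam_of_mem hM (Set.mem_univ x) (Set.mem_univ a)

theorem dist_act_le_sSup_Dsup {M : Type*} [MetricSpace M]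
    (hM : Bornology.IsBounded (Set.univ : Set M)) {G : Type*} (act : G → M → M)
    (r : G) (x y : M) :
    dist x (act r y) ≤ sSup (Set.range fun r : G => Dsup x (orbitOf (act r) y)) := by
  have hbdd : BddAbove (Set.range fun r : G => Dsup x (orbitOf (act r) y)) := by
    refine ⟨Metric.diam (Set.univ : Set M), ?_⟩
    rintro _ ⟨r, rfl⟩
    exact Dsup_le_diam hM x _
  calc dist x (act r y) ≤ Dsup x (orbitOf (act r) y) :=
        le_csSup (bddAbove_dist_image hM x _) ⟨act r y, ⟨1, rfl⟩, rfl⟩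
    _ ≤ _ := le_csSup hbdd ⟨r, rfl⟩

theorem iterate_act {M G : Type*} [Group G] (act : G → M → M)
    (hid : ∀ x : M, act 1 x = x)
    (hcomp : ∀ s t : G, ∀ x : M, act (s * t) x = act s (act t x)) (t : G) (n : ℕ) (x : M) :
    (act t)^[n] x = act (t ^ n) x := by
  induction n with
  | zero => simp [hid]
  | succ n ih => rw [Function.iterate_succ_apply', ih, pow_succ', hcomp]

theorem stmt0 {M : Type*} [MetricSpace M]
    (hM : Bornology.IsBounded (Set.univ : Set M))
    {G : Type*} [Group G] (act : G → M → M)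
    (hid : ∀ x : M, act 1 x = x)
    (hcomp : ∀ s t : G, ∀ x : M, act (s * t) x = act s (act t x))
    (hone : ∀ s : G, OrbitNonexpansive (act s)) :
    ∀ s t : G, ∀ x y : M,
      dist (act t x) (act s y) ≤ sSup (Set.range fun r : G => Dsup x (orbitOf (act r) y)) := by
  intro s t x y
  have hfactor : act s y = act t (act (t⁻¹ * s) y) := by
    rw [← hcomp, mul_inv_cancel_left]
  rw [hfactor]
  refine (hone t x (act (t⁻¹ * s) y)).trans (csSup_le ⟨_, _, ⟨0, rfl⟩, rfl⟩ ?_)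
  rintro _ ⟨_, ⟨n, rfl⟩, rfl⟩
  simp only [iterate_act act hid hcomp, ← hcomp]
  exact dist_act_le_sSup_Dsup hM act _ x y
end

section
/- Let (M,d) be a bounded metric space with metric normal structure such that the family A(M) of admissible subsets is compact, and let F be a family of interlaced orbit-nonexpansive self-maps of M. Then there exists a point of M fixed by every mapping in F; moreover, the set Fix(F) of common fixed points of F is a one-local retract of M. -/
open Metric Set

lemma Admissible.iInter_closedBall {M : Type*} [MetricSpace M] (C : Set (M × ℝ)) :
    Admissible (⋂ p ∈ C, closedBall p.1 p.2) :=
  ⟨C, rfl⟩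

lemma Admissible.sInter {M : Type*} [MetricSpace M] {c : Set (Set M)}
    (hc : ∀ A ∈ c, Admissible A) : Admissible (⋂₀ c) := by
  refine ⟨{p | ∃ A ∈ c, A ⊆ closedBall p.1 p.2}, Subset.antisymm ?_ ?_⟩
  · refine subset_iInter₂ fun p hp => ?_
    obtain ⟨A, hA, hAp⟩ := hp
    exact (sInter_subset_of_mem hA).trans hAp
  · refine subset_sInter fun A hA => ?_
    obtain ⟨C, rfl⟩ := hc A hA
    exact subset_iInter₂ fun p hp =>
      biInter_subset_of_mem (t := fun p : M × ℝ => closedBall p.1 p.2)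
        ⟨_, hA, biInter_subset_of_mem hp⟩

lemma Admissible.inter {M : Type*} [MetricSpace M] {A B : Set M}
    (hA : Admissible A) (hB : Admissible B) : Admissible (A ∩ B) := by
  rw [← sInter_pair]
  exact Admissible.sInter (by rintro _ (rfl | rfl) <;> assumption)

lemma Admissible.Bball {M : Type*} [MetricSpace M] (A : Set M) (r : ℝ) :
    Admissible (Bball A r) :=
  ⟨(fun x => (x, r)) '' A, by simp [_root_.Bball]⟩

lemma AdmissibleCompact.sInter_nonempty_of_isChain {M : Type*} [MetricSpace M] [Nonempty M]
    (hcomp : AdmissibleCompact M) {c : Set (Set M)} (hadm : ∀ A ∈ c, Admissible A)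
    (hne : ∀ A ∈ c, A.Nonempty) (hchain : IsChain (· ⊆ ·) c) : (⋂₀ c).Nonempty := by
  refine hcomp c hadm fun 𝒟 h𝒟 hfin => ?_
  rcases 𝒟.eq_empty_or_nonempty with rfl | hD
  · simp
  · obtain ⟨m, hm⟩ := hfin.exists_minimal hD
    refine (hne m (h𝒟 hm.prop)).mono (subset_sInter fun B hB => ?_)
    exact (hchain.total (h𝒟 hm.prop) (h𝒟 hB)).elim id fun h => hm.le_of_le hB h

lemma orbitOf_subset {M : Type*} {T : M → M} {A : Set M} (hT : MapsTo T A A) {x : M}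
    (hx : x ∈ A) : orbitOf T x ⊆ A := by
  rintro _ ⟨n, rfl⟩
  exact hT.iterate n hx

/-- An interlaced family satisfies `d(Tx,Sy) ≤ r` as soon as every orbit of `y` lies in the closed
ball of radius `r` around `x`. -/
lemma InterlacedFamily.dist_le {M : Type*} [MetricSpace M] {F : Set (M → M)}
    (hF : InterlacedFamily F) {T S : M → M} (hT : T ∈ F) (hS : S ∈ F) {x y : M} {r : ℝ}
    (hr : 0 ≤ r) (h : ∀ R ∈ F, ∀ a ∈ orbitOf R y, dist x a ≤ r) : dist (T x) (S y) ≤ r := by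
  refine (hF T hT S hS x y).trans (Real.sSup_le ?_ hr)
  rintro _ ⟨R, hR, rfl⟩
  refine Real.sSup_le ?_ hr
  rintro _ ⟨a, ha, rfl⟩
  exact h R hR a ha

lemma dist_le_Dsup {M : Type*} [MetricSpace M] (hM : Bornology.IsBounded (univ : Set M))
    {x a : M} {A : Set M} (ha : a ∈ A) : dist x a ≤ Dsup x A := by
  refine le_csSup ⟨diam (univ : Set M), ?_⟩ (mem_image_of_mem _ ha)
  rintro _ ⟨b, -, rfl⟩
  exact dist_le_diam_of_mem hM (mem_univ _) (mem_univ _)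

/-- Every nonempty admissible set invariant under an interlaced orbit-nonexpansive family contains
a common fixed point of the family. -/
lemma InterlacedFamily.exists_fixed_mem {M : Type*} [MetricSpace M]
    (hM : Bornology.IsBounded (univ : Set M))
    (hns : MetricNormalStructure M) (hcomp : AdmissibleCompact M)
    {F : Set (M → M)} (hF : InterlacedFamily F) {B : Set M} (hB : Admissible B)
    (hBne : B.Nonempty) (hBF : ∀ T ∈ F, MapsTo T B B) : ∃ x ∈ B, ∀ T ∈ F, T x = x := by
  have : Nonempty M := hBne.to_type
  rcases F.eq_empty_or_nonempty with rfl | ⟨T₀, hT₀⟩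
  · exact hBne.imp fun x hx => ⟨hx, by simp⟩
  obtain ⟨A, hAB, hmin⟩ := zorn_superset_nonempty
    {A : Set M | Admissible A ∧ A.Nonempty ∧ ∀ T ∈ F, MapsTo T A A} (by
      intro c hc hchain _
      refine ⟨⋂₀ c, ⟨Admissible.sInter fun A hA => (hc hA).1,
        hcomp.sInter_nonempty_of_isChain (fun A hA => (hc hA).1) (fun A hA => (hc hA).2.1) hchain,
        fun T hT x hx A hA => (hc hA).2.2 T hT (hx A hA)⟩, fun s hs => sInter_subset_of_mem hs⟩)
    B ⟨hB, hBne, hBF⟩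
  obtain ⟨hAadm, hAne, hAF⟩ := hmin.prop
  rcases hAne.exists_eq_singleton_or_nontrivial with ⟨x, rfl⟩ | hnt
  · exact ⟨x, hAB rfl, fun T hT => hAF T hT rfl⟩
  exfalso
  -- By minimality, a closed ball containing the images of `A` contains `A`.
  have hcov : ∀ (z : M) (r : ℝ), (∀ S ∈ F, ∀ y ∈ A, S y ∈ closedBall z r) →
      A ⊆ closedBall z r := by
    intro z r hz
    have hsub := hmin.le_of_le (y := A ∩ ⋂ p ∈ ({(z, r)} : Set (M × ℝ)), closedBall p.1 p.2)
      ⟨hAadm.inter (Admissible.iInter_closedBall _), ?_, ?_⟩ inter_subset_left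
    · exact fun x hx => by simpa using (hsub hx).2
    · obtain ⟨a, ha⟩ := hAne
      exact ⟨T₀ a, hAF T₀ hT₀ ha, by simpa using hz T₀ hT₀ a ha⟩
    · exact fun T hT x hx => ⟨hAF T hT hx.1, by simpa using hz T hT x hx.1⟩
  obtain ⟨z, hzA, hz⟩ := hns A hAadm hnt
  have hr : 0 ≤ Dsup z A := dist_nonneg.trans (dist_le_Dsup hM hzA)
  have hle : A ⊆ A ∩ Bball A (Dsup z A) := by
    refine hmin.le_of_le ⟨hAadm.inter (Admissible.Bball _ _), ⟨z, hzA, ?_⟩, ?_⟩ inter_subset_left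
    · exact mem_iInter₂.2 fun a ha => dist_le_Dsup hM ha
    · rintro T hT x ⟨hxA, hx⟩
      have hx' := mem_iInter₂.1 hx
      refine ⟨hAF T hT hxA, mem_iInter₂.2 fun a ha => ?_⟩
      rw [mem_closedBall_comm]
      refine hcov (T x) _ (fun S hS y hy => ?_) ha
      rw [mem_closedBall_comm]
      exact hF.dist_le hT hS hr fun R hR b hb => hx' b (orbitOf_subset (hAF R hR) hy hb)
  refine hz.not_ge (diam_le_of_forall_dist_le hr fun x hx y hy => ?_)
  exact mem_iInter₂.1 (hle hx).2 y hy

theorem stmt1 {M : Type*} [MetricSpace M] [Nonempty M]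
    (hM : Bornology.IsBounded (Set.univ : Set M))
    (hns : MetricNormalStructure M) (hcomp : AdmissibleCompact M)
    (F : Set (M → M)) (hF : InterlacedFamily F) :
    (∃ x : M, ∀ T ∈ F, T x = x) ∧ OneLocalRetract {x : M | ∀ T ∈ F, T x = x} := by
  constructor
  · obtain ⟨x, -, hx⟩ := hF.exists_fixed_mem hM hns hcomp (B := univ) ⟨∅, by simp⟩ univ_nonempty
      fun T _ => mapsTo_univ _ _
    exact ⟨x, hx⟩
  · intro C hC hne
    refine hF.exists_fixed_mem hM hns hcomp (Admissible.iInter_closedBall C) hne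
      fun T hT x hx => mem_iInter₂.2 fun p hp => ?_
    have hxp : dist x p.1 ≤ p.2 := mem_iInter₂.1 hx p hp
    have hdist : dist (T x) (T p.1) ≤ p.2 := by
      refine hF.dist_le hT hT (dist_nonneg.trans hxp) fun R hR a ha => ?_
      obtain rfl : a = p.1 :=
        orbitOf_subset (A := {p.1}) (fun y hy => by rw [hy]; exact hC p hp R hR) rfl ha
      exact hxp
    rwa [hC p hp T hT] at hdist
end

section
/- Let X be a Banach space with weak normal structure, let M be a nonempty convex weakly compact subset of X, and let S be a group acting on M by self-maps, each of which is orbit-nonexpansive. Then there exists x ∈ M such that s(x) = x for all s ∈ S. -/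
open Metric Set

/-- A subset of a normed space is weakly compact if its image in `WeakSpace ℝ X`
(i.e. `X` with the weak topology) is compact. -/
def WeaklyCompactSet {X : Type*} [NormedAddCommGroup X] [NormedSpace ℝ X] (C : Set X) : Prop :=
  IsCompact ((toWeakSpace ℝ X) '' C)

/-- `X` has weak normal structure. -/
def WeakNormalStructure (X : Type*) [NormedAddCommGroup X] [NormedSpace ℝ X] : Prop :=
  ∀ C : Set X, Convex ℝ C → WeaklyCompactSet C → C.Nontrivial →
    ∃ z ∈ C, Dsup z C < Metric.diam C

/-- The image of a norm-closed convex set in the weak topology is closed. -/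
theorem Convex.isClosed_image_toWeakSpace {X : Type*} [NormedAddCommGroup X] [NormedSpace ℝ X]
    {F : Set X} (hF : Convex ℝ F) (hcl : IsClosed F) : IsClosed (toWeakSpace ℝ X '' F) := by
  have h := hF.toWeakSpace_closure ℝ
  rw [hcl.closure_eq] at h
  rw [h]
  exact isClosed_closure

theorem WeaklyCompactSet.inter_convex {X : Type*} [NormedAddCommGroup X] [NormedSpace ℝ X]
    {M F : Set X} (hM : WeaklyCompactSet M) (hF : Convex ℝ F) (hcl : IsClosed F) :
    WeaklyCompactSet (M ∩ F) := by
  rw [WeaklyCompactSet, image_inter (toWeakSpace ℝ X).injective]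
  exact hM.inter_right (hF.isClosed_image_toWeakSpace hcl)

/-- A nonempty chain of closed convex sets, each meeting a weakly compact set `M`, has an
intersection that meets `M`. -/
theorem WeaklyCompactSet.inter_sInter_nonempty {X : Type*} [NormedAddCommGroup X]
    [NormedSpace ℝ X] {M : Set X} (hM : WeaklyCompactSet M) {c : Set (Set X)}
    (hc : IsChain (· ⊆ ·) c) (hne : c.Nonempty) (hconv : ∀ F ∈ c, Convex ℝ F)
    (hcl : ∀ F ∈ c, IsClosed F) (hmeet : ∀ F ∈ c, (M ∩ F).Nonempty) :
    (M ∩ ⋂₀ c).Nonempty := by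
  have : Nonempty c := hne.to_subtype
  by_contra hempty
  have hdir : Directed (· ⊇ ·) fun F : c => toWeakSpace ℝ X '' (F : Set X) := by
    intro F F'
    rcases hc.total F.2 F'.2 with h | h
    · exact ⟨F, subset_rfl, image_mono h⟩
    · exact ⟨F', image_mono h, subset_rfl⟩
  obtain ⟨F, hF⟩ := hM.elim_directed_family_closed
    (fun F : c => toWeakSpace ℝ X '' (F : Set X))
    (fun F => (hconv F F.2).isClosed_image_toWeakSpace (hcl F F.2))
    (by
      rw [← image_iInter (toWeakSpace ℝ X).bijective,
        ← image_inter (toWeakSpace ℝ X).injective, ← sInter_eq_iInter,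
        not_nonempty_iff_eq_empty.mp hempty, image_empty]) hdir
  rw [← image_inter (toWeakSpace ℝ X).injective, image_eq_empty] at hF
  exact (hmeet F F.2).ne_empty hF

theorem OrbitNonexpansive.dist_le_of_mapsTo {M : Type*} [MetricSpace M] {T : M → M}
    (hT : OrbitNonexpansive T) {A : Set M} (hA : MapsTo T A A) {x y : M} (hy : y ∈ A) {r : ℝ}
    (hr : ∀ a ∈ A, dist x a ≤ r) : dist (T x) (T y) ≤ r := by
  refine (hT x y).trans (csSup_le ⟨_, mem_image_of_mem _ ⟨0, rfl⟩⟩ ?_)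
  rintro _ ⟨_, ⟨n, rfl⟩, rfl⟩
  exact hr _ (hA.iterate n hy)

/-- In a space with weak normal structure, a convex weakly compact set with more than one point
has a radius smaller than its diameter that is attained as a covering radius. -/
theorem WeakNormalStructure.exists_dist_le_lt_diam {X : Type*} [NormedAddCommGroup X]
    [NormedSpace ℝ X] (hX : WeakNormalStructure X) {K : Set X} (hconv : Convex ℝ K)
    (hcomp : WeaklyCompactSet K) (hnt : K.Nontrivial) :
    ∃ z ∈ K, ∃ r < Metric.diam K, ∀ k ∈ K, dist z k ≤ r := by
  obtain ⟨z, hz, hlt⟩ := hX K hconv hcomp hnt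
  refine ⟨z, hz, _, hlt, fun k hk => le_csSup ?_ (mem_image_of_mem _ hk)⟩
  have hnonneg : 0 ≤ Dsup z K := by
    apply Real.sSup_nonneg
    rintro _ ⟨k, -, rfl⟩
    exact dist_nonneg
  have hbdd : Bornology.IsBounded K := by
    by_contra h
    rw [Metric.diam_eq_zero_of_unbounded h] at hlt
    exact hlt.not_ge hnonneg
  refine ⟨Metric.diam K, ?_⟩
  rintro _ ⟨k, hk, rfl⟩
  exact Metric.dist_le_diam_of_mem hbdd hz hk

theorem stmt6 {X : Type*} [NormedAddCommGroup X] [NormedSpace ℝ X] [CompleteSpace X]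
    (hwns : WeakNormalStructure X)
    (M : Set X) (hne : M.Nonempty) (hconv : Convex ℝ M) (hcomp : WeaklyCompactSet M)
    {G : Type*} [Group G] (act : G → M → M)
    (hid : ∀ x : M, act 1 x = x)
    (hcompose : ∀ s t : G, ∀ x : M, act (s * t) x = act s (act t x))
    (hone : ∀ s : G, OrbitNonexpansive (act s)) :
    ∃ x : M, ∀ s : G, act s x = x := by
  let 𝓕 : Set (Set X) := {F | Convex ℝ F ∧ IsClosed F ∧ (M ∩ F).Nonempty ∧
    ∀ s, MapsTo (act s) (Subtype.val ⁻¹' F) (Subtype.val ⁻¹' F)}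
  have huniv : univ ∈ 𝓕 := ⟨convex_univ, isClosed_univ, by simpa using hne, fun _ _ _ => mem_univ _⟩
  obtain ⟨F, -, hF⟩ := zorn_superset_nonempty 𝓕 (fun c hc hchain hcne =>
    ⟨⋂₀ c, ⟨convex_sInter fun F h => (hc h).1, isClosed_sInter fun F h => (hc h).2.1,
      hcomp.inter_sInter_nonempty hchain hcne (fun F h => (hc h).1) (fun F h => (hc h).2.1)
        fun F h => (hc h).2.2.1,
      fun s _ hx F h => (hc h).2.2.2 s (hx F h)⟩, fun _ => sInter_subset_of_mem⟩) univ huniv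
  obtain ⟨hFconv, hFcl, ⟨x, hxM, hxF⟩, hFinv⟩ := hF.prop
  rcases (M ∩ F).subsingleton_or_nontrivial with hsub | hnt
  · exact ⟨⟨x, hxM⟩, fun s => Subtype.ext <|
      hsub ⟨(act s ⟨x, hxM⟩).2, hFinv s hxF⟩ ⟨hxM, hxF⟩⟩
  obtain ⟨z, hz, r, hlt, hr⟩ := hwns.exists_dist_le_lt_diam (hconv.inter hFconv)
    (hcomp.inter_convex hFconv hFcl) hnt
  have hsmaller : F ∩ ⋂ k ∈ M ∩ F, closedBall k r ∈ 𝓕 := by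
    refine ⟨hFconv.inter (convex_iInter₂ fun k _ => convex_closedBall k r),
      hFcl.inter (isClosed_biInter fun k _ => isClosed_closedBall),
      ⟨z, hz.1, hz.2, mem_iInter₂.2 hr⟩, fun s y hy => ⟨hFinv s hy.1, mem_iInter₂.2 ?_⟩⟩
    rintro k ⟨hkM, hkF⟩
    have hdist := (hone s).dist_le_of_mapsTo (hFinv s) (x := y) (y := act s⁻¹ ⟨k, hkM⟩)
      (hFinv s⁻¹ hkF) fun a ha => mem_iInter₂.1 hy.2 a ⟨a.2, ha⟩
    rwa [← hcompose, mul_inv_cancel, hid] at hdist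
  have hsub := hF.le_of_le hsmaller inter_subset_left
  refine absurd hlt (Metric.diam_le_of_forall_dist_le_of_nonempty ⟨z, hz⟩ ?_).not_gt
  exact fun a ha b hb => mem_iInter₂.1 (hsub ha.2).2 b hb
end

section
/- Let (M,d) be a bounded metric space with uniform relative normal structure such that the family A(M) of admissible subsets is compact, and let S be a group acting on M by self-maps, each of which is orbit-nonexpansive. Then there exists x ∈ M such that s(x) = x for all s ∈ S. -/
open Metric Set

/-- Uniform relative normal structure. -/
def UniformRelativeNormalStructure (M : Type*) [MetricSpace M] : Prop :=
  ∃ c : ℝ, 0 < c ∧ c < 1 ∧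
    ∀ A : Set M, Admissible A → 0 < Metric.diam A →
      ∃ z : M, Dsup z A ≤ c * Metric.diam A ∧
        ∀ x : M, Dsup x A ≤ c * Metric.diam A → dist x z ≤ c * Metric.diam A

theorem le_Dsup {M : Type*} [MetricSpace M] (hM : Bornology.IsBounded (Set.univ : Set M))
    (x : M) {A : Set M} {a : M} (ha : a ∈ A) : dist x a ≤ Dsup x A := by
  refine le_csSup ⟨Metric.diam (Set.univ : Set M), ?_⟩ ⟨a, ha, rfl⟩
  rintro _ ⟨b, -, rfl⟩
  exact Metric.dist_le_diam_of_mem hM (mem_univ _) (mem_univ _)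

theorem Dsup_le {M : Type*} [MetricSpace M] {x : M} {A : Set M} (hA : A.Nonempty) {r : ℝ}
    (h : ∀ a ∈ A, dist x a ≤ r) : Dsup x A ≤ r := by
  refine csSup_le (hA.image _) ?_
  rintro _ ⟨a, ha, rfl⟩
  exact h a ha

/-- The smallest admissible set containing `A`. -/
def admissibleHull {M : Type*} [MetricSpace M] (A : Set M) : Set M :=
  ⋂ p ∈ {p : M × ℝ | A ⊆ Metric.closedBall p.1 p.2}, Metric.closedBall p.1 p.2

theorem admissible_admissibleHull {M : Type*} [MetricSpace M] (A : Set M) :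
    Admissible (admissibleHull A) :=
  ⟨_, rfl⟩

theorem subset_admissibleHull {M : Type*} [MetricSpace M] (A : Set M) :
    A ⊆ admissibleHull A :=
  subset_iInter₂ fun _ hp => hp

theorem admissibleHull_subset_closedBall {M : Type*} [MetricSpace M] {A : Set M} {w : M} {r : ℝ}
    (h : A ⊆ Metric.closedBall w r) : admissibleHull A ⊆ Metric.closedBall w r :=
  biInter_subset_of_mem (show (w, r) ∈ {p : M × ℝ | A ⊆ Metric.closedBall p.1 p.2} from h)

/-- Passing to the admissible hull does not increase the diameter. -/
theorem dist_le_of_mem_admissibleHull {M : Type*} [MetricSpace M] {A : Set M} {r : ℝ}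
    (h : ∀ a ∈ A, ∀ b ∈ A, dist a b ≤ r) {a b : M} (ha : a ∈ admissibleHull A)
    (hb : b ∈ admissibleHull A) : dist a b ≤ r := by
  refine admissibleHull_subset_closedBall (w := b) (fun o ho => ?_) ha
  rw [mem_closedBall, dist_comm]
  exact admissibleHull_subset_closedBall (fun o' ho' => h o' ho' o ho) hb

/-- The maps of the action preserve any bound on the distances from a point to a group orbit. -/
theorem dist_act_le_of_forall_dist_le {M : Type*} [MetricSpace M] {G : Type*} [Group G]
    {act : G → M → M} (hid : ∀ x : M, act 1 x = x)
    (hcomp : ∀ s t : G, ∀ x : M, act (s * t) x = act s (act t x))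
    (hone : ∀ s : G, OrbitNonexpansive (act s)) {x y : M} {r : ℝ}
    (h : ∀ t, dist y (act t x) ≤ r) (s t : G) : dist (act s y) (act t x) ≤ r := by
  have hiter : ∀ (n : ℕ) (z : M), (act s)^[n] z = act (s ^ n) z := by
    intro n
    induction n with
    | zero => intro z; simp [hid]
    | succ n ih => intro z; rw [Function.iterate_succ_apply, ih, pow_succ, hcomp]
  have key := hone s y (act (s⁻¹ * t) x)
  rw [← hcomp, mul_inv_cancel_left] at key
  refine key.trans (Dsup_le (range_nonempty _) ?_)
  rintro _ ⟨n, rfl⟩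
  simp only [hiter, ← hcomp]
  exact h _

/-- Given a group orbit of diameter at most `r`, uniform relative normal structure yields a point
within `c * r` of that orbit whose own orbit has diameter at most `c * r`. -/
theorem exists_orbit_contraction {M : Type*} [MetricSpace M]
    (hM : Bornology.IsBounded (Set.univ : Set M)) {c : ℝ} (hc : 0 < c)
    (hurns : ∀ A : Set M, Admissible A → 0 < Metric.diam A →
      ∃ z : M, Dsup z A ≤ c * Metric.diam A ∧
        ∀ x : M, Dsup x A ≤ c * Metric.diam A → dist x z ≤ c * Metric.diam A)
    {G : Type*} [Group G] {act : G → M → M} (hid : ∀ x : M, act 1 x = x)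
    (hcomp : ∀ s t : G, ∀ x : M, act (s * t) x = act s (act t x))
    (hone : ∀ s : G, OrbitNonexpansive (act s)) {x : M} {r : ℝ}
    (hx : ∀ s t, dist (act s x) (act t x) ≤ r) :
    ∃ y, (∀ s t, dist (act s y) (act t y) ≤ c * r) ∧ ∀ t, dist y (act t x) ≤ c * r := by
  have hr : 0 ≤ r := dist_nonneg.trans (hx 1 1)
  set H := admissibleHull (range fun t => act t x)
  have hmem : ∀ t, act t x ∈ H := fun t => subset_admissibleHull _ ⟨t, rfl⟩
  have hdiam : Metric.diam H ≤ r := by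
    refine Metric.diam_le_of_forall_dist_le hr fun a ha b hb =>
      dist_le_of_mem_admissibleHull ?_ ha hb
    rintro _ ⟨s, rfl⟩ _ ⟨t, rfl⟩
    exact hx s t
  have hbd : Bornology.IsBounded H := hM.subset (subset_univ _)
  rcases (Metric.diam_nonneg (s := H)).eq_or_lt with h0 | hpos
  · have hz : ∀ s t, dist (act s x) (act t x) ≤ c * r := fun s t =>
      ((Metric.dist_le_diam_of_mem hbd (hmem s) (hmem t)).trans h0.ge).trans (by positivity)
    exact ⟨x, hz, fun t => by simpa only [hid] using hz 1 t⟩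
  · obtain ⟨z, hz, huniq⟩ := hurns H (admissible_admissibleHull _) hpos
    have hle : c * Metric.diam H ≤ c * r := by gcongr
    have hzx : ∀ t, dist z (act t x) ≤ c * Metric.diam H := fun t =>
      (le_Dsup hM z (hmem t)).trans hz
    have hsz : ∀ s, dist z (act s z) ≤ c * Metric.diam H := fun s => by
      rw [dist_comm]
      refine huniq _ (Dsup_le ⟨_, hmem 1⟩ fun a ha => ?_)
      rw [dist_comm]
      refine admissibleHull_subset_closedBall ?_ ha
      rintro _ ⟨t, rfl⟩
      rw [mem_closedBall, dist_comm]
      exact dist_act_le_of_forall_dist_le hid hcomp hone hzx s t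
    exact ⟨z, fun s t => (dist_act_le_of_forall_dist_le hid hcomp hone hsz s t).trans hle,
      fun t => (hzx t).trans hle⟩

/-- Compactness of the admissible sets gives a common point of a nested sequence of balls. -/
theorem AdmissibleCompact.exists_forall_dist_le {M : Type*} [MetricSpace M]
    (hcompact : AdmissibleCompact M) {u : ℕ → M} {ρ : ℕ → ℝ} (hρ : ∀ n, 0 ≤ ρ n)
    (h : ∀ n, dist (u (n + 1)) (u n) + ρ (n + 1) ≤ ρ n) : ∃ x, ∀ n, dist x (u n) ≤ ρ n := by
  have hanti : Antitone fun n => Metric.closedBall (u n) (ρ n) :=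
    antitone_nat_of_succ_le fun n =>
      Metric.closedBall_subset_closedBall' (by linarith [h n])
  have hne : (⋂₀ range fun n => Metric.closedBall (u n) (ρ n)).Nonempty := by
    refine hcompact _ ?_ ?_
    · rintro _ ⟨n, rfl⟩
      exact ⟨{(u n, ρ n)}, by simp⟩
    · intro 𝒟 h𝒟 hfin
      have hev : ∀ᶠ n in Filter.atTop, ∀ B ∈ 𝒟, u n ∈ B := by
        refine (Filter.eventually_all_finite hfin).2 fun B hB => ?_
        obtain ⟨k, rfl⟩ := h𝒟 hB
        filter_upwards [Filter.eventually_ge_atTop k] with n hn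
        exact hanti hn (Metric.mem_closedBall_self (hρ n))
      obtain ⟨n, hn⟩ := hev.exists
      exact ⟨u n, hn⟩
  obtain ⟨x, hx⟩ := hne
  exact ⟨x, fun n => hx _ ⟨n, rfl⟩⟩

theorem stmt10 {M : Type*} [MetricSpace M] [Nonempty M]
    (hM : Bornology.IsBounded (Set.univ : Set M))
    (hurns : UniformRelativeNormalStructure M)
    (hcompact : AdmissibleCompact M)
    {G : Type*} [Group G] (act : G → M → M)
    (hid : ∀ x : M, act 1 x = x)
    (hcomp : ∀ s t : G, ∀ x : M, act (s * t) x = act s (act t x))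
    (hone : ∀ s : G, OrbitNonexpansive (act s)) :
    ∃ x : M, ∀ s : G, act s x = x := by
  obtain ⟨c, hc0, hc1, hc⟩ := hurns
  set R := Metric.diam (Set.univ : Set M)
  have hR : 0 ≤ R := Metric.diam_nonneg
  have hstep : ∀ (n : ℕ) (x : M), ∃ y, (∀ s t, dist (act s x) (act t x) ≤ c ^ n * R) →
      (∀ s t, dist (act s y) (act t y) ≤ c ^ (n + 1) * R) ∧ dist y x ≤ c ^ (n + 1) * R := by
    intro n x
    by_cases hx : ∀ s t, dist (act s x) (act t x) ≤ c ^ n * R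
    · obtain ⟨y, hy, hyx⟩ := exists_orbit_contraction hM hc0 hc hid hcomp hone hx
      rw [← mul_assoc, ← pow_succ'] at hy hyx
      exact ⟨y, fun _ => ⟨hy, by simpa only [hid] using hyx 1⟩⟩
    · exact ⟨x, fun h => absurd h hx⟩
  choose f hf using hstep
  obtain ⟨x₀⟩ := ‹Nonempty M›
  let u : ℕ → M := fun n => Nat.rec x₀ f n
  have hu : ∀ n s t, dist (act s (u n)) (act t (u n)) ≤ c ^ n * R := by
    intro n
    induction n with
    | zero =>
      intro s t
      rw [pow_zero, one_mul]
      exact Metric.dist_le_diam_of_mem hM (mem_univ _) (mem_univ _)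
    | succ n ih => exact (hf n (u n) ih).1
  have hd : ∀ n, dist (u (n + 1)) (u n) ≤ c ^ (n + 1) * R := fun n => (hf n (u n) (hu n)).2
  have h1c : 0 < 1 - c := sub_pos.2 hc1
  set K := R / (1 - c)
  have hK0 : 0 ≤ K := by positivity
  have hKR : K * (1 - c) = R := div_mul_cancel₀ _ h1c.ne'
  obtain ⟨x, hx⟩ := hcompact.exists_forall_dist_le (u := u) (ρ := fun n => c ^ n * K)
    (fun n => by positivity) fun n => by
      have h1 := hd n
      have h2 : c ^ (n + 1) * R ≤ c ^ n * R := by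
        gcongr ?_ * R
        exact pow_le_pow_of_le_one hc0.le hc1.le n.le_succ
      have h3 : c ^ n * R + c ^ (n + 1) * K = c ^ n * K := by rw [← hKR]; ring
      linarith
  refine ⟨x, fun s => ?_⟩
  have hbound : ∀ n, dist (act s x) x ≤ c ^ n * (2 * K + R) := by
    intro n
    have h1 : dist (act s x) (u n) ≤ c ^ n * K + c ^ n * R := by
      have := dist_act_le_of_forall_dist_le (x := u n) hid hcomp hone (fun t =>
        (dist_triangle x (u n) _).trans
          (add_le_add (hx n) (by simpa only [hid] using hu n 1 t))) s 1
      rwa [hid] at this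
    have h2 := dist_triangle_right (act s x) x (u n)
    linarith [hx n]
  have hlim : Filter.Tendsto (fun n : ℕ => c ^ n * (2 * K + R)) Filter.atTop (nhds 0) := by
    simpa using (tendsto_pow_atTop_nhds_zero_of_lt_one hc0.le hc1).mul_const (2 * K + R)
  exact dist_le_zero.1 (ge_of_tendsto' hlim hbound)
end

section
/- Let T : [-1,1] → [-1,1] be defined by T(x) = x/3 if x is irrational and T(x) = -x/3 if x is rational. Then T is orbit-nonexpansive, i.e. |Tx - Ty| ≤ D(x, o_T(y)) for all x, y ∈ [-1,1], even though T is discontinuous at every point x ≠ 0. -/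
open Metric Set

/-- Every nonempty open interval contains a number whose rationality differs from that of `x`. -/
theorem exists_between_irrational_iff_not (x : ℝ) {a b : ℝ} (hab : a < b) :
    ∃ z, a < z ∧ z < b ∧ (Irrational z ↔ ¬ Irrational x) := by
  by_cases hx : Irrational x
  · obtain ⟨q, h1, h2⟩ := exists_rat_btwn hab
    exact ⟨q, h1, h2, by simp [hx]⟩
  · obtain ⟨r, hr, h1, h2⟩ := exists_irrational_btwn hab
    exact ⟨r, h1, h2, by simp [hx, hr]⟩

/-- Arbitrarily close to a nonzero `x` there is a point of the same sign, no larger in absolute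
value, whose rationality differs from that of `x`. -/
theorem exists_near_irrational_iff_not {x δ : ℝ} (hx : x ≠ 0) (hδ : 0 < δ) :
    ∃ z, |z - x| < δ ∧ |z| ≤ |x| ∧ 0 < x * z ∧ (Irrational z ↔ ¬ Irrational x) := by
  rcases lt_or_gt_of_ne hx with h | h
  · obtain ⟨z, h1, h2, hz⟩ := exists_between_irrational_iff_not x
      (show x < min (x + δ) 0 from lt_min (by linarith) h)
    obtain ⟨h3, h4⟩ := lt_min_iff.1 h2
    refine ⟨z, abs_lt.2 ⟨by linarith, by linarith⟩, ?_, mul_pos_of_neg_of_neg h h4, hz⟩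
    rw [abs_of_neg h, abs_of_neg h4]
    linarith
  · obtain ⟨z, h1, h2, hz⟩ := exists_between_irrational_iff_not x
      (show max (x - δ) 0 < x from max_lt (by linarith) h)
    obtain ⟨h3, h4⟩ := max_lt_iff.1 h1
    refine ⟨z, abs_lt.2 ⟨by linarith, by linarith⟩, ?_, mul_pos h h4, hz⟩
    rw [abs_of_pos h, abs_of_pos h4]
    linarith

theorem dist_iterate_le_Dsup {M : Type*} [MetricSpace M] [BoundedSpace M] (T : M → M)
    (x y : M) (n : ℕ) : dist x (T^[n] y) ≤ Dsup x (orbitOf T y) := by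
  refine le_csSup ⟨Metric.diam (Set.univ : Set M), ?_⟩ ⟨_, ⟨n, rfl⟩, rfl⟩
  rintro _ ⟨z, -, rfl⟩
  exact Metric.dist_le_diam_of_mem (Bornology.IsBounded.all _) (Set.mem_univ _) (Set.mem_univ _)

theorem abs_iterate_eq {s : Set ℝ} {T : s → s} (hT : ∀ x, |(T x : ℝ)| = |(x : ℝ)| / 3) (y : s)
    (n : ℕ) : |(T^[n] y : ℝ)| = |(y : ℝ)| * (1 / 3) ^ n := by
  induction n with
  | zero => simp
  | succ n ih => rw [Function.iterate_succ_apply', hT, ih]; ring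

/-- Iterates of `y` tend to `0`, so `|x|` is a lower bound for `D(x, o_T(y))`. -/
theorem abs_le_Dsup_orbitOf {s : Set ℝ} [BoundedSpace s] {T : s → s}
    (hT : ∀ x, |(T x : ℝ)| = |(x : ℝ)| / 3) (x y : s) :
    |(x : ℝ)| ≤ Dsup x (orbitOf T y) := by
  have hlim : Filter.Tendsto (fun n : ℕ => |(x : ℝ)| - |(y : ℝ)| * (1 / 3) ^ n) Filter.atTop
      (nhds (|(x : ℝ)| - |(y : ℝ)| * 0)) :=
    ((tendsto_pow_atTop_nhds_zero_of_lt_one (by norm_num) (by norm_num)).const_mul _).const_sub _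
  rw [mul_zero, sub_zero] at hlim
  refine le_of_tendsto' hlim fun n => le_trans ?_ (dist_iterate_le_Dsup T x y n)
  rw [Subtype.dist_eq, Real.dist_eq, ← abs_iterate_eq hT]
  exact abs_sub_abs_le_abs_sub _ _

theorem stmt12 (T : Set.Icc (-1 : ℝ) 1 → Set.Icc (-1 : ℝ) 1)
    (hirr : ∀ x : Set.Icc (-1 : ℝ) 1, Irrational (x : ℝ) → (T x : ℝ) = (x : ℝ) / 3)
    (hrat : ∀ x : Set.Icc (-1 : ℝ) 1, ¬ Irrational (x : ℝ) → (T x : ℝ) = -((x : ℝ) / 3)) :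
    OrbitNonexpansive T ∧
      ∀ x : Set.Icc (-1 : ℝ) 1, (x : ℝ) ≠ 0 → ¬ ContinuousAt T x := by
  have hT : ∀ x, |(T x : ℝ)| = |(x : ℝ)| / 3 := by
    intro x
    by_cases hx : Irrational (x : ℝ)
    · rw [hirr x hx, abs_div, abs_of_pos (three_pos : (0 : ℝ) < 3)]
    · rw [hrat x hx, abs_neg, abs_div, abs_of_pos (three_pos : (0 : ℝ) < 3)]
  refine ⟨fun x y => ?_, fun x hx hc => ?_⟩
  · have h0 := abs_le_Dsup_orbitOf hT x y
    have h1 : |(x : ℝ) - y| ≤ Dsup x (orbitOf T y) := dist_iterate_le_Dsup T x y 0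
    have h2 : |(y : ℝ)| - |(x : ℝ)| ≤ |(x : ℝ) - y| := by
      rw [abs_sub_comm]
      exact abs_sub_abs_le_abs_sub _ _
    have h3 : dist (T x) (T y) ≤ (|(x : ℝ)| + |(y : ℝ)|) / 3 := by
      rw [Subtype.dist_eq, Real.dist_eq, add_div, ← hT, ← hT]
      exact abs_sub _ _
    rcases le_total |(y : ℝ)| (2 * |(x : ℝ)|) <;> linarith
  · obtain ⟨δ, hδ, hball⟩ := Metric.continuousAt_iff.1 hc (|(x : ℝ)| / 3) (by positivity)
    obtain ⟨z, hzδ, hzx, hpos, hz⟩ := exists_near_irrational_iff_not hx hδ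
    have hzM : z ∈ Set.Icc (-1 : ℝ) 1 := abs_le.1 (hzx.trans (abs_le.2 x.2))
    have hlt := @hball ⟨z, hzM⟩ hzδ
    have hsum : |(T ⟨z, hzM⟩ : ℝ) - T x| = |(x : ℝ) + z| / 3 := by
      by_cases hxi : Irrational (x : ℝ)
      · rw [hirr x hxi, hrat ⟨z, hzM⟩ (by simpa [hxi] using hz), ← abs_neg,
          show -(-(z / 3) - (x : ℝ) / 3) = (x + z) / 3 by ring, abs_div,
          abs_of_pos (three_pos : (0 : ℝ) < 3)]
      · rw [hrat x hxi, hirr ⟨z, hzM⟩ (hz.2 hxi),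
          show z / 3 - -((x : ℝ) / 3) = (x + z) / 3 by ring, abs_div,
          abs_of_pos (three_pos : (0 : ℝ) < 3)]
    rw [Subtype.dist_eq, Real.dist_eq, hsum] at hlt
    have hsq : |(x : ℝ) + z| < |(x : ℝ)| := by linarith
    rw [← sq_lt_sq] at hsq
    nlinarith [sq_nonneg z]
end

section
/- Let (M,d) be a bounded metric space and T : M → M a mean nonexpansive mapping, i.e. there exist a, b ≥ 0 with a + b ≤ 1 such that d(Tx,Ty) ≤ a·d(x,y) + b·d(x,Ty) for all x, y ∈ M. Then T is orbit-nonexpansive. -/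
open Metric Set

theorem stmt16 {M : Type*} [MetricSpace M]
    (hM : Bornology.IsBounded (Set.univ : Set M))
    (T : M → M) (a b : ℝ) (ha : 0 ≤ a) (hb : 0 ≤ b) (hab : a + b ≤ 1)
    (h : ∀ x y : M, dist (T x) (T y) ≤ a * dist x y + b * dist x (T y)) :
    OrbitNonexpansive T := by
  intro x y
  have hbdd : BddAbove (dist x '' orbitOf T y) := by
    obtain ⟨C, hC⟩ := Metric.isBounded_iff.1 hM
    refine ⟨C, ?_⟩
    rintro _ ⟨z, -, rfl⟩
    exact hC (mem_univ x) (mem_univ z)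
  have h₀ : dist x y ≤ Dsup x (orbitOf T y) :=
    le_csSup hbdd ⟨y, ⟨0, rfl⟩, rfl⟩
  have h₁ : dist x (T y) ≤ Dsup x (orbitOf T y) :=
    le_csSup hbdd ⟨T y, ⟨1, rfl⟩, rfl⟩
  have hD : 0 ≤ Dsup x (orbitOf T y) := dist_nonneg.trans h₀
  calc dist (T x) (T y) ≤ a * dist x y + b * dist x (T y) := h x y
    _ ≤ a * Dsup x (orbitOf T y) + b * Dsup x (orbitOf T y) := by gcongr
    _ = (a + b) * Dsup x (orbitOf T y) := by ring
    _ ≤ Dsup x (orbitOf T y) := mul_le_of_le_one_left hD hab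
end

section
/- Let T : ℓ∞ → ℓ∞ be defined by T(x) = (1 + limsup_n x_n, x_1, x_2, …, x_n, …), where ℓ∞ is the Banach space of bounded real sequences with the supremum norm. Then T is an isometry (‖Tx − Ty‖_∞ = ‖x − y‖_∞ for all x,y ∈ ℓ∞), T has no fixed point, and every orbit o_T(x) := {x} ∪ {T^n x : n ≥ 1} of T is bounded. -/
open Metric Set

open Filter in
theorem lp_top_isBoundedUnder_le (x : lp (fun _ : ℕ => ℝ) (⊤ : ENNReal)) :
    IsBoundedUnder (· ≤ ·) atTop (fun n => (x : ℕ → ℝ) n) :=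
  isBoundedUnder_of ⟨‖x‖, fun n =>
    (abs_le.1 (lp.norm_apply_le_norm ENNReal.top_ne_zero x n)).2⟩

open Filter in
theorem lp_top_isBoundedUnder_ge (x : lp (fun _ : ℕ => ℝ) (⊤ : ENNReal)) :
    IsBoundedUnder (· ≥ ·) atTop (fun n => (x : ℕ → ℝ) n) :=
  isBoundedUnder_of ⟨-‖x‖, fun n =>
    (abs_le.1 (lp.norm_apply_le_norm ENNReal.top_ne_zero x n)).1⟩

open Filter in
theorem lp_top_limsup_le_add_norm_sub (x y : lp (fun _ : ℕ => ℝ) (⊤ : ENNReal)) :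
    limsup (fun n => (x : ℕ → ℝ) n) atTop ≤
      limsup (fun n => (y : ℕ → ℝ) n) atTop + ‖x - y‖ := by
  rw [← limsup_add_const atTop (fun n => (y : ℕ → ℝ) n) ‖x - y‖
    (lp_top_isBoundedUnder_le y) (lp_top_isBoundedUnder_ge y).isCoboundedUnder_le]
  refine limsup_le_limsup (Eventually.of_forall fun n => ?_)
    (lp_top_isBoundedUnder_ge x).isCoboundedUnder_le ?_
  · have h := (abs_le.1 (lp.norm_apply_le_norm ENNReal.top_ne_zero (x - y) n)).2
    rw [lp.coeFn_sub, Pi.sub_apply] at h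
    linarith
  · obtain ⟨b, hb⟩ := lp_top_isBoundedUnder_le y
    rw [eventually_map] at hb
    refine ⟨b + ‖x - y‖, eventually_map.2 ?_⟩
    filter_upwards [hb] with n hn
    linarith

open Filter in
theorem lp_top_abs_limsup_sub_le (x y : lp (fun _ : ℕ => ℝ) (⊤ : ENNReal)) :
    |limsup (fun n => (x : ℕ → ℝ) n) atTop - limsup (fun n => (y : ℕ → ℝ) n) atTop| ≤
      ‖x - y‖ := by
  have h₁ := lp_top_limsup_le_add_norm_sub x y
  have h₂ := lp_top_limsup_le_add_norm_sub y x
  rw [norm_sub_rev] at h₂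
  exact abs_le.2 ⟨by linarith, by linarith⟩

open Filter in
theorem lp_top_abs_limsup_le (x : lp (fun _ : ℕ => ℝ) (⊤ : ENNReal)) :
    |limsup (fun n => (x : ℕ → ℝ) n) atTop| ≤ ‖x‖ := by
  simpa using lp_top_abs_limsup_sub_le x 0

theorem stmt18 (T : lp (fun _ : ℕ => ℝ) (⊤ : ENNReal) → lp (fun _ : ℕ => ℝ) (⊤ : ENNReal))
    (hT0 : ∀ x : lp (fun _ : ℕ => ℝ) (⊤ : ENNReal),
      (T x : ℕ → ℝ) 0 = 1 + Filter.limsup (fun n => (x : ℕ → ℝ) n) Filter.atTop)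
    (hTs : ∀ x : lp (fun _ : ℕ => ℝ) (⊤ : ENNReal), ∀ n : ℕ,
      (T x : ℕ → ℝ) (n + 1) = (x : ℕ → ℝ) n) :
    (∀ x y : lp (fun _ : ℕ => ℝ) (⊤ : ENNReal), ‖T x - T y‖ = ‖x - y‖) ∧
      (∀ x : lp (fun _ : ℕ => ℝ) (⊤ : ENNReal), T x ≠ x) ∧
      (∀ x : lp (fun _ : ℕ => ℝ) (⊤ : ENNReal), Bornology.IsBounded (orbitOf T x)) := by
  refine ⟨fun x y => le_antisymm ?_ ?_, fun x hx => ?_, fun x => ?_⟩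
  · refine lp.norm_le_of_forall_le (norm_nonneg _) fun n => ?_
    rw [lp.coeFn_sub, Pi.sub_apply]
    cases n with
    | zero =>
      rw [hT0, hT0, add_sub_add_left_eq_sub]
      exact lp_top_abs_limsup_sub_le x y
    | succ n =>
      rw [hTs, hTs]
      exact lp.norm_apply_le_norm ENNReal.top_ne_zero (x - y) n
  · refine lp.norm_le_of_forall_le (norm_nonneg _) fun n => ?_
    have h := lp.norm_apply_le_norm ENNReal.top_ne_zero (T x - T y) (n + 1)
    rwa [lp.coeFn_sub, Pi.sub_apply, hTs, hTs] at h
  · have hc : ∀ n, (x : ℕ → ℝ) n = (x : ℕ → ℝ) 0 := by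
      intro n
      induction n with
      | zero => rfl
      | succ n ih =>
        have h := hTs x n
        rw [hx] at h
        exact h.trans ih
    have h := hT0 x
    rw [hx, funext hc, Filter.limsup_const] at h
    linarith
  · have hlim : ∀ y, Filter.limsup (fun n => (T y : ℕ → ℝ) n) Filter.atTop =
        Filter.limsup (fun n => (y : ℕ → ℝ) n) Filter.atTop := by
      intro y
      rw [← Filter.limsup_nat_add (fun n => (T y : ℕ → ℝ) n) 1]
      simp only [hTs]
    have hbound : ∀ n : ℕ, Filter.limsup (fun k => (T^[n] x : ℕ → ℝ) k) Filter.atTop =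
        Filter.limsup (fun k => (x : ℕ → ℝ) k) Filter.atTop ∧ ‖T^[n] x‖ ≤ 1 + ‖x‖ := by
      intro n
      induction n with
      | zero => exact ⟨rfl, by simp⟩
      | succ n ih =>
        rw [Function.iterate_succ_apply']
        refine ⟨(hlim _).trans ih.1, lp.norm_le_of_forall_le (by positivity) fun k => ?_⟩
        cases k with
        | zero =>
          rw [hT0, ih.1]
          refine (norm_add_le _ _).trans ?_
          rw [norm_one]
          exact add_le_add_right (lp_top_abs_limsup_le x) 1
        | succ k =>
          rw [hTs]
          exact (lp.norm_apply_le_norm ENNReal.top_ne_zero _ k).trans ih.2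
    refine isBounded_iff_forall_norm_le.2 ⟨1 + ‖x‖, ?_⟩
    rintro _ ⟨n, rfl⟩
    exact (hbound n).2
end
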